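/- Let γ = (1,2,...,n)(-1,-2,...,-n) ∈ W_n. Then the interval [ε, γ] ⊆ W_n (with respect to the partial order coming from (W_n, R_n)) is order-isomorphic to NC^A(n). More precisely, let ι_o : NC^A(n) → NC^B(n) be the map sending p = {F₁,...,F_k} to {F₁,...,F_k,-F₁,...,-F_k}, and ι : NC^B(n) → W_n the cycle map; then ι ∘ ι_o has range [ε, γ] and induces a poset isomorphism between NC^A(n) and [ε, γ]. -/

import Mathlib

open scoped Classical

namespace NCPB

/-- A collection of subsets of `α` is a partition: blocks are nonempty and
every element lies in exactly one block. -/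
def IsPartition {α : Type*} (P : Set (Set α)) : Prop :=
  (∀ B ∈ P, B.Nonempty) ∧ ∀ a : α, ∃! B, B ∈ P ∧ a ∈ B

/-- The non-crossing condition for a collection of subsets of a linear order:
if `a < b < c < d`, `a, c` lie in a block `B` and `b, d` lie in a block `C`,
then `b ∈ B` (i.e. the blocks coincide). -/
def IsNC {α : Type*} [LinearOrder α] (P : Set (Set α)) : Prop :=
  ∀ B ∈ P, ∀ C ∈ P, ∀ a b c d : α, a < b → b < c → c < d →
    a ∈ B → c ∈ B → b ∈ C → d ∈ C → b ∈ B

/-- A non-crossing partition of a linear order. -/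
def NCPart {α : Type*} [LinearOrder α] (P : Set (Set α)) : Prop :=
  IsPartition P ∧ IsNC P

/-- The set `[±m] = {1 < 2 < ... < m < -1 < -2 < ... < -m}` is encoded as `Fin (2*m)`,
position `k < m` encoding `k+1` and position `m + j` encoding `-(j+1)`.
`negMap` is the inversion map `a ↦ -a`. -/
def negMap (m : ℕ) (k : Fin (2*m)) : Fin (2*m) :=
  ⟨(k.val + m) % (2*m), Nat.mod_lt _ (Nat.lt_of_le_of_lt (Nat.zero_le _) k.isLt)⟩

/-- Image of a subset of `[±m]` under the inversion map, i.e. `X ↦ -X`. -/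
def negSet (m : ℕ) (X : Set (Fin (2*m))) : Set (Fin (2*m)) := negMap m '' X

/-- The absolute value map `[±m] → {1,...,m}`, `±i ↦ i`. -/
def absMap (m : ℕ) (k : Fin (2*m)) : Fin m :=
  ⟨k.val % m, Nat.mod_lt _ (by have := k.isLt; omega)⟩

/-- A non-crossing partition of type B: a non-crossing partition of `[±m]`
invariant under the inversion map. -/
def NCBPart (m : ℕ) (π : Set (Set (Fin (2*m)))) : Prop :=
  NCPart π ∧ ∀ B ∈ π, negSet m B ∈ π

/-- The collection of sets `Abs(X)`, `X` a block of `π`. -/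
def absPart (m : ℕ) (π : Set (Set (Fin (2*m)))) : Set (Set (Fin m)) :=
  {F | ∃ X ∈ π, F = absMap m '' X}

/-- The embedding of `{1,...,m}` onto the odd-indexed positions of the interleaved
set `1 < 1̄ < 2 < 2̄ < ... < m < m̄` (encoded as `Fin (2*m)`): `i ↦ i` (even positions). -/
def evens (m : ℕ) (i : Fin m) : Fin (2*m) := ⟨2*i.val, by have := i.isLt; omega⟩

/-- The embedding of the barred copy `{1̄,...,m̄}` into the interleaved set: odd positions. -/
def odds (m : ℕ) (i : Fin m) : Fin (2*m) := ⟨2*i.val+1, by have := i.isLt; omega⟩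

/-- `P` refines... rather: every block of `P` is contained in a block of `Q`
(the partial order on partitions by reverse refinement: `P ≤ Q`). -/
def Refines {α : Type*} (P Q : Set (Set α)) : Prop := ∀ B ∈ P, ∃ C ∈ Q, B ⊆ C

/-- The collection `p ∪ q̄` of subsets of the interleaved set
`1 < 1̄ < 2 < 2̄ < ... < m < m̄`, with `p` living on the unbarred copy and `q` on the
barred copy. -/
def interleave (m : ℕ) (p q : Set (Set (Fin m))) : Set (Set (Fin (2*m))) :=
  ((fun B => evens m '' B) '' p) ∪ ((fun B => odds m '' B) '' q)

/-- `q` is the Kreweras complement of `p`: `q` is the largest non-crossing partition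
(in the reverse-refinement order) such that `p ∪ q̄` is a non-crossing partition of the
interleaved set `1 < 1̄ < ... < m < m̄`. -/
def IsKr (m : ℕ) (p q : Set (Set (Fin m))) : Prop :=
  NCPart q ∧ NCPart (interleave m p q) ∧
  ∀ q', NCPart q' → NCPart (interleave m p q') → Refines q' q

/-- Two sets cross: there are `a < b < c < d` with `a, c ∈ B` and `b, d ∈ C`. -/
def Crossing {α : Type*} [LinearOrder α] (B C : Set α) : Prop :=
  ∃ a b c d : α, a < b ∧ b < c ∧ c < d ∧ a ∈ B ∧ c ∈ B ∧ b ∈ C ∧ d ∈ C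

/-- Two members of a non-crossing family of pairwise disjoint sets: disjoint,
and neither crosses the other. -/
def PairNC {α : Type*} [LinearOrder α] (B C : Set α) : Prop :=
  Disjoint B C ∧ ¬ Crossing B C ∧ ¬ Crossing C B

end NCPB
namespace NCPB

/-- The generating set `R_n` of the hyperoctahedral group: all transpositions `(i,-i)`
and all products `(i,j)(-i,-j)` with `|i| ≠ |j|`. -/
def Rn (n : ℕ) : Set (Equiv.Perm (Fin (2*n))) :=
  {ρ | (∃ i, ρ = Equiv.swap i (negMap n i)) ∨
       (∃ i j, absMap n i ≠ absMap n j ∧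
          ρ = Equiv.swap i j * Equiv.swap (negMap n i) (negMap n j))}

/-- Membership in the hyperoctahedral group `W_n`: permutations of `[±n]` commuting
with the inversion map. -/
def InWn (n : ℕ) (τ : Equiv.Perm (Fin (2*n))) : Prop :=
  ∀ k, τ (negMap n k) = negMap n (τ k)

/-- Word-length with respect to the generating set `R_n`. -/
noncomputable def lenB (n : ℕ) (τ : Equiv.Perm (Fin (2*n))) : ℕ :=
  sInf {k | ∃ l : List (Equiv.Perm (Fin (2*n))),
    (∀ ρ ∈ l, ρ ∈ Rn n) ∧ l.length = k ∧ l.prod = τ}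

/-- The partial order on `W_n` coming from `(W_n, R_n)`: `a ≤ b` iff `|a| + |a⁻¹b| = |b|`. -/
def leB (n : ℕ) (a b : Equiv.Perm (Fin (2*n))) : Prop :=
  lenB n a + lenB n (a⁻¹ * b) = lenB n b

/-- `b` covers `a` in the partial order coming from `(W_n, R_n)`. -/
def CoversB (n : ℕ) (a b : Equiv.Perm (Fin (2*n))) : Prop :=
  leB n a b ∧ lenB n b = lenB n a + 1

/-- The orbits of a permutation. -/
def orbitsOf (n : ℕ) (τ : Equiv.Perm (Fin (2*n))) : Set (Set (Fin (2*n))) :=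
  {O | ∃ x, O = {y | τ.SameCycle x y}}

/-- Word-length with respect to the set of all transpositions of a symmetric group. -/
noncomputable def lenA (N : ℕ) (τ : Equiv.Perm (Fin N)) : ℕ :=
  sInf {k | ∃ l : List (Equiv.Perm (Fin N)),
    (∀ ρ ∈ l, ρ.IsSwap) ∧ l.length = k ∧ l.prod = τ}

/-- The partial order on the symmetric group coming from all transpositions. -/
def leA (N : ℕ) (a b : Equiv.Perm (Fin N)) : Prop :=
  lenA N a + lenA N (a⁻¹ * b) = lenA N b

/-- `τ = ι(π)`: for each block `B` of `π` and `a ∈ B`, `τ a` is the cyclic successor of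
`a` in `B` (the least element of `B` greater than `a`, or the least element of `B` if
`a` is the largest element of `B`). -/
def IsIota (N : ℕ) (π : Set (Set (Fin N))) (τ : Equiv.Perm (Fin N)) : Prop :=
  ∀ B ∈ π, ∀ a ∈ B,
    ((∃ b ∈ B, a < b) → IsLeast {b | b ∈ B ∧ a < b} (τ a)) ∧
    ((∀ b ∈ B, ¬ a < b) → IsLeast B (τ a))

/-- The long inversion-invariant cycle `ω = (1, 2, ..., n, -1, -2, ..., -n)`. -/
def omegaW (n : ℕ) : Equiv.Perm (Fin (2*n)) := finRotate (2*n)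

end NCPB
namespace NCPB

/-- The long cycle of non-invariant type `γ = (1,2,...,n)(-1,-2,...,-n) ∈ W_n`
(obtained as `ω · (n,-n)`). -/
def gammaW (n : ℕ) (hn : 0 < n) : Equiv.Perm (Fin (2*n)) :=
  finRotate (2*n) * Equiv.swap ⟨n-1, by omega⟩ ⟨2*n-1, by omega⟩

/-- The inclusion `{1,...,n} ⊆ [±n]`. -/
def castEmb (n : ℕ) (i : Fin n) : Fin (2*n) := ⟨i.val, by have := i.isLt; omega⟩

/-- The map `ι₀ : NC^A(n) → NC^B(n)`, sending `p = {F₁,...,F_k}` to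
`{F₁,...,F_k,-F₁,...,-F_k}`. -/
def iotaO (n : ℕ) (p : Set (Set (Fin n))) : Set (Set (Fin (2*n))) :=
  {X | ∃ F ∈ p, X = castEmb n '' F ∨ X = negSet n (castEmb n '' F)}

end NCPB

namespace NCPB

section LinearAlgebra

variable {E : Type*} [AddCommGroup E] [Module ℚ E] [FiniteDimensional ℚ E]

theorem finrank_add_finrank_le_of_inf_le {U W X : Submodule ℚ E} (h : U ⊓ W ≤ X) :
    Module.finrank ℚ U + Module.finrank ℚ W ≤ Module.finrank ℚ E + Module.finrank ℚ X := by
  have h1 := Submodule.finrank_sup_add_finrank_inf_eq U W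
  have h2 := Submodule.finrank_mono h
  have h3 := Submodule.finrank_le (U ⊔ W)
  omega

theorem le_left_of_finrank_le {U W X : Submodule ℚ E} (h : U ⊓ W ≤ X)
    (hd : Module.finrank ℚ E + Module.finrank ℚ X ≤
      Module.finrank ℚ U + Module.finrank ℚ W) : X ≤ U := by
  have h1 := Submodule.finrank_sup_add_finrank_inf_eq U W
  have h3 := Submodule.finrank_le (U ⊔ W)
  have h4 : U ⊓ W = X := Submodule.eq_of_le_of_finrank_le h (by omega)
  exact h4 ▸ inf_le_left

theorem finrank_le_finrank_add_card {ι : Type*} [Fintype ι] {U : Submodule ℚ E}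
    (φ : E →ₗ[ℚ] (ι → ℚ)) (h : ∀ g, φ g = 0 → g ∈ U) :
    Module.finrank ℚ E ≤ Module.finrank ℚ U + Fintype.card ι := by
  have h1 := LinearMap.finrank_range_add_finrank_ker φ
  have h2 := Submodule.finrank_le (LinearMap.range φ)
  have h3 : Module.finrank ℚ (LinearMap.ker φ) ≤ Module.finrank ℚ U :=
    Submodule.finrank_mono fun g hg => h g (by simpa using hg)
  rw [Module.finrank_fintype_fun_eq_card] at h2
  omega

end LinearAlgebra

section SignedFunctions

variable {n : ℕ}

theorem negMap_val (k : Fin (2 * n)) :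
    (negMap n k).val = if k.val < n then k.val + n else k.val - n := by
  have := k.isLt
  simp only [negMap]
  split_ifs with h
  · exact Nat.mod_eq_of_lt (by omega)
  · rw [show k.val + n = (k.val - n) + 2 * n by omega, Nat.add_mod_right]
    exact Nat.mod_eq_of_lt (by omega)

@[simp] theorem negMap_negMap (k : Fin (2 * n)) : negMap n (negMap n k) = k := by
  ext
  have := k.isLt
  have h1 := negMap_val k
  have h2 := negMap_val (negMap n k)
  split_ifs at h1 h2 <;> omega

theorem negMap_inj {j k : Fin (2 * n)} : negMap n j = negMap n k ↔ j = k :=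
  ⟨fun h => by rw [← negMap_negMap j, h, negMap_negMap], fun h => h ▸ rfl⟩

theorem negMap_ne (k : Fin (2 * n)) : negMap n k ≠ k := by
  intro h
  have := congrArg Fin.val h
  have := k.isLt
  rw [negMap_val] at *
  split_ifs at * <;> omega

theorem absMap_val (k : Fin (2 * n)) :
    (absMap n k).val = if k.val < n then k.val else k.val - n := by
  have := k.isLt
  simp only [absMap]
  split_ifs with h
  · exact Nat.mod_eq_of_lt h
  · rw [Nat.mod_eq_sub_mod (by omega)]
    exact Nat.mod_eq_of_lt (by omega)

theorem absMap_ne {i j : Fin (2 * n)} (h1 : i ≠ j) (h2 : j ≠ negMap n i) :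
    absMap n i ≠ absMap n j := by
  intro h
  have h := congrArg Fin.val h
  have := i.isLt
  have := j.isLt
  rw [Ne, Fin.ext_iff] at h1 h2
  rw [negMap_val] at h2
  rw [absMap_val, absMap_val] at h
  split_ifs at * <;> omega

theorem absMap_negMap (i : Fin (2 * n)) : absMap n (negMap n i) = absMap n i := by
  ext
  have := i.isLt
  rw [absMap_val, absMap_val, negMap_val]
  split_ifs <;> omega

theorem castEmb_or_negMap (k : Fin (2 * n)) :
    (∃ i, k = castEmb n i) ∨ ∃ i, k = negMap n (castEmb n i) := by
  have := k.isLt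
  by_cases h : k.val < n
  · exact Or.inl ⟨⟨k, h⟩, rfl⟩
  · refine Or.inr ⟨⟨k - n, by omega⟩, ?_⟩
    ext
    have h' : k.val - n < n := by omega
    rw [negMap_val, if_pos (show (castEmb n ⟨k.val - n, h'⟩).val < n from h')]
    change k.val = k.val - n + n
    omega

/-- The extension of a function on `{1,...,n}` to an odd function on `[±n]`. -/
def oddExt (g : Fin n → ℚ) (k : Fin (2 * n)) : ℚ :=
  if k.val < n then g (absMap n k) else -g (absMap n k)

theorem oddExt_negMap (g : Fin n → ℚ) (k : Fin (2 * n)) :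
    oddExt g (negMap n k) = -oddExt g k := by
  have := k.isLt
  unfold oddExt
  rw [absMap_negMap, negMap_val]
  by_cases h : k.val < n
  · simp [h]
  · have h' : k.val - n < n := by omega
    simp [h, h']

theorem oddExt_castEmb (g : Fin n → ℚ) (i : Fin n) : oddExt g (castEmb n i) = g i := by
  have h : absMap n (castEmb n i) = i := by
    ext
    simp [absMap_val, castEmb]
  rw [oddExt, h, if_pos (show (castEmb n i).val < n from i.isLt)]

theorem oddExt_add (g g' : Fin n → ℚ) (k : Fin (2 * n)) :
    oddExt (g + g') k = oddExt g k + oddExt g' k := by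
  unfold oddExt
  split_ifs
  · rfl
  · simp only [Pi.add_apply]; ring

theorem oddExt_smul (c : ℚ) (g : Fin n → ℚ) (k : Fin (2 * n)) :
    oddExt (c • g) k = c * oddExt g k := by
  unfold oddExt
  split_ifs <;> simp

/-- The functions on `{1,...,n}` whose odd extension is fixed by `τ`. -/
def fixB (τ : Equiv.Perm (Fin (2 * n))) : Submodule ℚ (Fin n → ℚ) where
  carrier := {g | ∀ k, oddExt g (τ k) = oddExt g k}
  add_mem' ha hb k := by rw [oddExt_add, oddExt_add, ha k, hb k]
  zero_mem' k := by simp [oddExt]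
  smul_mem' c g hg k := by rw [oddExt_smul, oddExt_smul, hg k]

theorem fixB_inf_le_mul (a b : Equiv.Perm (Fin (2 * n))) : fixB a ⊓ fixB b ≤ fixB (a * b) := by
  rintro g ⟨ha, hb⟩ k
  rw [Equiv.Perm.mul_apply, ha, hb]

theorem finrank_fixB_one : Module.finrank ℚ (fixB (1 : Equiv.Perm (Fin (2 * n)))) = n := by
  have : fixB (1 : Equiv.Perm (Fin (2 * n))) = ⊤ := by
    rw [eq_top_iff]
    intro g _ k
    rfl
  rw [this, finrank_top, Module.finrank_fin_fun]

theorem finrank_fixB_mul (a b : Equiv.Perm (Fin (2 * n))) :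
    Module.finrank ℚ (fixB a) + Module.finrank ℚ (fixB b) ≤
      n + Module.finrank ℚ (fixB (a * b)) := by
  simpa using finrank_add_finrank_le_of_inf_le (fixB_inf_le_mul a b)

theorem mem_fixB_swap {i j : Fin (2 * n)} {g : Fin n → ℚ} (h : oddExt g i = oddExt g j) :
    g ∈ fixB (Equiv.swap i j) := by
  intro k
  rw [Equiv.swap_apply_def]
  split_ifs with h1 h2
  · rw [h1, h]
  · rw [h2, h]
  · rfl

theorem exists_of_mem_Rn {ρ : Equiv.Perm (Fin (2 * n))} (h : ρ ∈ Rn n) :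
    ∃ i j, ∀ g, oddExt g i = oddExt g j → g ∈ fixB ρ := by
  rcases h with ⟨i, rfl⟩ | ⟨i, j, -, rfl⟩
  · exact ⟨i, negMap n i, fun g => mem_fixB_swap⟩
  · refine ⟨i, j, fun g hg => fixB_inf_le_mul _ _ ⟨mem_fixB_swap hg, mem_fixB_swap ?_⟩⟩
    rw [oddExt_negMap, oddExt_negMap, hg]

theorem le_finrank_fixB_of_mem_Rn {ρ : Equiv.Perm (Fin (2 * n))} (h : ρ ∈ Rn n) :
    n ≤ Module.finrank ℚ (fixB ρ) + 1 := by
  obtain ⟨i, j, hij⟩ := exists_of_mem_Rn h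
  let φ : (Fin n → ℚ) →ₗ[ℚ] (Unit → ℚ) :=
    { toFun := fun g _ => oddExt g i - oddExt g j
      map_add' := fun g g' => by
        funext
        simp only [oddExt_add, Pi.add_apply]
        ring
      map_smul' := fun c g => by
        funext
        simp only [oddExt_smul, RingHom.id_apply, Pi.smul_apply, smul_eq_mul]
        ring }
  simpa using finrank_le_finrank_add_card (U := fixB ρ) φ
    fun g hg => hij g (sub_eq_zero.1 (congrFun hg ()))

theorem swap_negMap (i j k : Fin (2 * n)) : Equiv.swap i j (negMap n k) =
    negMap n (Equiv.swap (negMap n i) (negMap n j) k) := by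
  have h1 : ∀ i, (negMap n k = i ↔ k = negMap n i) := fun i => by
    rw [← negMap_inj, negMap_negMap]
  rw [Equiv.swap_apply_def, Equiv.swap_apply_def]
  simp only [h1]
  split_ifs <;> simp

theorem swap_mul_swap_negMap_comm {i j : Fin (2 * n)} (h : absMap n i ≠ absMap n j) :
    Equiv.swap i j * Equiv.swap (negMap n i) (negMap n j) =
      Equiv.swap (negMap n i) (negMap n j) * Equiv.swap i j := by
  have e : ∀ a b : Fin (2 * n), absMap n a ≠ absMap n b → a ≠ b := fun a b h h' => h (h' ▸ rfl)
  refine (Equiv.Perm.disjoint_swap_swap ?_).commute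
  simp only [List.nodup_cons, List.mem_cons, List.not_mem_nil, or_false, not_or, not_false_eq_true,
    List.nodup_nil, and_true]
  refine ⟨⟨e _ _ h, (negMap_ne i).symm, e _ _ (by rwa [absMap_negMap])⟩,
    ⟨e _ _ (by rw [absMap_negMap]; exact h.symm), (negMap_ne j).symm⟩, ?_⟩
  rw [negMap_inj]
  exact e _ _ h

theorem inWn_of_mem_Rn {ρ : Equiv.Perm (Fin (2 * n))} (h : ρ ∈ Rn n) : InWn n ρ := by
  rcases h with ⟨i, rfl⟩ | ⟨i, j, hij, rfl⟩
  · intro k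
    rw [swap_negMap, negMap_negMap, Equiv.swap_comm]
  · intro k
    rw [Equiv.Perm.mul_apply, swap_negMap, swap_negMap, negMap_negMap, negMap_negMap,
      swap_mul_swap_negMap_comm hij, Equiv.Perm.mul_apply]

theorem inWn_one : InWn n 1 := fun _ => rfl

theorem InWn.mul {a b : Equiv.Perm (Fin (2 * n))} (ha : InWn n a) (hb : InWn n b) :
    InWn n (a * b) := fun k => by
  rw [Equiv.Perm.mul_apply, hb, ha, Equiv.Perm.mul_apply]

theorem InWn.inv {a : Equiv.Perm (Fin (2 * n))} (ha : InWn n a) : InWn n a⁻¹ := fun k => by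
  rw [Equiv.Perm.inv_eq_iff_eq, ha]; simp

theorem inWn_list_prod {l : List (Equiv.Perm (Fin (2 * n)))} (h : ∀ ρ ∈ l, ρ ∈ Rn n) :
    InWn n l.prod := by
  induction l with
  | nil => exact inWn_one
  | cons ρ l ih =>
    rw [List.prod_cons]
    exact (inWn_of_mem_Rn (h ρ (by simp))).mul (ih fun ρ' h' => h ρ' (by simp [h']))

theorem le_finrank_fixB_list_prod {l : List (Equiv.Perm (Fin (2 * n)))}
    (h : ∀ ρ ∈ l, ρ ∈ Rn n) : n ≤ Module.finrank ℚ (fixB l.prod) + l.length := by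
  induction l with
  | nil => exact (finrank_fixB_one (n := n)).ge
  | cons ρ l ih =>
    have h1 := le_finrank_fixB_of_mem_Rn (h ρ (by simp))
    have h2 := ih fun ρ' h' => h ρ' (by simp [h'])
    have h3 := finrank_fixB_mul ρ l.prod
    rw [List.prod_cons, List.length_cons]
    omega

theorem exists_mem_Rn_of_ne {τ : Equiv.Perm (Fin (2 * n))} {i : Fin (2 * n)}
    (hi : τ i ≠ i) :
    ∃ ρ ∈ Rn n, ρ * ρ = 1 ∧ ρ (τ i) = i ∧ ∀ g, oddExt g i = oddExt g (τ i) → g ∈ fixB ρ := by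
  by_cases h : τ i = negMap n i
  · exact ⟨Equiv.swap i (negMap n i), Or.inl ⟨i, rfl⟩, Equiv.swap_mul_self _ _, by simp [h],
      fun g hg => mem_fixB_swap (h ▸ hg)⟩
  · have hab := absMap_ne hi.symm h
    refine ⟨_, Or.inr ⟨i, τ i, hab, rfl⟩, ?_, ?_, fun g hg =>
      fixB_inf_le_mul _ _ ⟨mem_fixB_swap hg, mem_fixB_swap ?_⟩⟩
    · nth_rw 1 [swap_mul_swap_negMap_comm hab]
      rw [mul_assoc, Equiv.swap_mul_self_mul, Equiv.swap_mul_self]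
    · rw [swap_mul_swap_negMap_comm hab, Equiv.Perm.mul_apply, Equiv.swap_apply_right,
        Equiv.swap_apply_of_ne_of_ne (negMap_ne i).symm]
      intro h'
      exact h (by conv_rhs => rw [h', negMap_negMap])
    · rw [oddExt_negMap, oddExt_negMap, hg]

theorem exists_oddExt_eq (i : Fin (2 * n)) :
    ∃ g : Fin n → ℚ, ∀ k, oddExt g k =
      (if k = i then 1 else 0) - (if k = negMap n i then 1 else 0) := by
  refine ⟨fun m => (if castEmb n m = i then 1 else 0) -
    (if castEmb n m = negMap n i then 1 else 0), fun k => ?_⟩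
  rcases castEmb_or_negMap k with ⟨m, rfl⟩ | ⟨m, rfl⟩
  · rw [oddExt_castEmb]
  · have h : negMap n (castEmb n m) = i ↔ castEmb n m = negMap n i := by
      rw [← negMap_inj, negMap_negMap]
    rw [oddExt_negMap, oddExt_castEmb]
    simp only [h, negMap_inj]
    ring

theorem finrank_fixB_lt_of_apply_eq {τ ρ : Equiv.Perm (Fin (2 * n))} {i : Fin (2 * n)}
    (hi : τ i ≠ i) (hρτ : InWn n (ρ * τ)) (h : ρ (τ i) = i)
    (hρ : ∀ g, oddExt g i = oddExt g (τ i) → g ∈ fixB ρ) :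
    Module.finrank ℚ (fixB τ) < Module.finrank ℚ (fixB (ρ * τ)) := by
  apply Submodule.finrank_lt_finrank_of_lt
  refine lt_of_le_of_ne (fun g hg => fixB_inf_le_mul _ _ ⟨hρ g (hg i).symm, hg⟩) fun he => ?_
  obtain ⟨g, hg⟩ := exists_oddExt_eq i
  have hmem : g ∈ fixB (ρ * τ) := by
    intro k
    have h1 : (ρ * τ) k = i ↔ k = i := by
      rw [← (ρ * τ).injective.eq_iff (a := k) (b := i), Equiv.Perm.mul_apply ρ τ i, h]
    have h2 : (ρ * τ) k = negMap n i ↔ k = negMap n i := by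
      rw [← (ρ * τ).injective.eq_iff (a := k) (b := negMap n i), hρτ, Equiv.Perm.mul_apply ρ τ i, h]
    rw [hg, hg]
    simp only [h1, h2]
  rw [← he] at hmem
  have := hmem i
  rw [hg, hg, if_neg hi, if_pos rfl, if_neg (negMap_ne i).symm] at this
  split_ifs at this <;> norm_num at this

theorem exists_list_of_inWn {τ : Equiv.Perm (Fin (2 * n))} (hτ : InWn n τ) :
    ∃ l : List (Equiv.Perm (Fin (2 * n))), (∀ ρ ∈ l, ρ ∈ Rn n) ∧ l.prod = τ ∧
      l.length + Module.finrank ℚ (fixB τ) = n := by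
  induction hm : n - Module.finrank ℚ (fixB τ) using Nat.strong_induction_on generalizing τ with
  | _ m ih =>
    by_cases h1 : τ = 1
    · exact ⟨[], by simp, by simp [h1], by rw [h1]; simpa using finrank_fixB_one⟩
    · obtain ⟨i, hi⟩ : ∃ i, τ i ≠ i := by
        by_contra! h
        exact h1 (Equiv.ext h)
      obtain ⟨ρ, hρ, hρρ, hρi, hg⟩ := exists_mem_Rn_of_ne hi
      have hW := (inWn_of_mem_Rn hρ).mul hτ
      have hlt := finrank_fixB_lt_of_apply_eq hi hW hρi hg
      have hle := Submodule.finrank_le (fixB (ρ * τ))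
      rw [Module.finrank_fin_fun] at hle
      obtain ⟨l, hl, hp, hlen⟩ := ih _ (by omega) hW rfl
      have hl' : ∀ ρ' ∈ ρ :: l, ρ' ∈ Rn n := by
        simpa using ⟨hρ, hl⟩
      have hp' : (ρ :: l).prod = τ := by
        rw [List.prod_cons, hp, ← mul_assoc, hρρ, one_mul]
      refine ⟨ρ :: l, hl', hp', ?_⟩
      have := le_finrank_fixB_list_prod hl'
      rw [hp', List.length_cons] at this
      rw [List.length_cons]
      omega

theorem lenB_add_finrank_fixB {τ : Equiv.Perm (Fin (2 * n))} (hτ : InWn n τ) :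
    lenB n τ + Module.finrank ℚ (fixB τ) = n := by
  obtain ⟨l, hl, hp, hlen⟩ := exists_list_of_inWn hτ
  have h1 : lenB n τ ≤ l.length := Nat.sInf_le ⟨l, hl, rfl, hp⟩
  obtain ⟨l', hl', hlen', hp'⟩ := Nat.sInf_mem
    (s := {k | ∃ l : List (Equiv.Perm (Fin (2*n))), (∀ ρ ∈ l, ρ ∈ Rn n) ∧ l.length = k ∧
      l.prod = τ}) ⟨_, l, hl, rfl, hp⟩
  have h2 := le_finrank_fixB_list_prod hl'
  rw [hp'] at h2
  change _ = lenB n τ at hlen'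
  omega

theorem lenB_eq_zero_of_not_inWn {τ : Equiv.Perm (Fin (2 * n))} (hτ : ¬ InWn n τ) :
    lenB n τ = 0 := by
  rw [lenB, Nat.sInf_eq_zero]
  right
  rw [Set.eq_empty_iff_forall_notMem]
  rintro k ⟨l, hl, -, rfl⟩
  exact hτ (inWn_list_prod hl)

theorem leB_iff_of_inWn {a b : Equiv.Perm (Fin (2 * n))} (ha : InWn n a) (hb : InWn n b) :
    leB n a b ↔ Module.finrank ℚ (fixB a) + Module.finrank ℚ (fixB (a⁻¹ * b)) =
      n + Module.finrank ℚ (fixB b) := by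
  have h1 := lenB_add_finrank_fixB ha
  have h2 := lenB_add_finrank_fixB hb
  have h3 := lenB_add_finrank_fixB (ha.inv.mul hb)
  rw [leB]
  omega

theorem leB_one (τ : Equiv.Perm (Fin (2 * n))) : leB n 1 τ := by
  have h1 := lenB_add_finrank_fixB (inWn_one (n := n))
  rw [finrank_fixB_one] at h1
  rw [leB, inv_one, one_mul]
  omega

theorem fixB_le_of_leB {a b : Equiv.Perm (Fin (2 * n))} (ha : InWn n a) (hb : InWn n b)
    (h : leB n a b) : fixB b ≤ fixB a := by
  refine le_left_of_finrank_le (W := fixB (a⁻¹ * b)) ?_ ?_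
  · simpa using fixB_inf_le_mul a (a⁻¹ * b)
  · rw [Module.finrank_fin_fun, (leB_iff_of_inWn ha hb).1 h]

end SignedFunctions

section Permutations

variable {n : ℕ}

/-- The functions on `{1,...,n}` which are constant on the cycles of `σ`. -/
def fixA (σ : Equiv.Perm (Fin n)) : Submodule ℚ (Fin n → ℚ) where
  carrier := {g | ∀ k, g (σ k) = g k}
  add_mem' ha hb k := by rw [Pi.add_apply, Pi.add_apply, ha k, hb k]
  zero_mem' _ := rfl
  smul_mem' c g hg k := by rw [Pi.smul_apply, Pi.smul_apply, hg k]

theorem fixA_inf_le_mul (a b : Equiv.Perm (Fin n)) : fixA a ⊓ fixA b ≤ fixA (a * b) := by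
  rintro g ⟨ha, hb⟩ k
  rw [Equiv.Perm.mul_apply, ha, hb]

theorem indicator_mem_fixA {σ : Equiv.Perm (Fin n)} {S : Set (Fin n)} :
    S.indicator (1 : Fin n → ℚ) ∈ fixA σ ↔ ∀ x, σ x ∈ S ↔ x ∈ S := by
  refine forall_congr' fun x => ?_
  by_cases h1 : σ x ∈ S <;> by_cases h2 : x ∈ S <;> simp [h1, h2]

theorem mem_fixA_swap {x y : Fin n} {g : Fin n → ℚ} (h : g x = g y) :
    g ∈ fixA (Equiv.swap x y) := by
  intro k
  rw [Equiv.swap_apply_def]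
  split_ifs with h1 h2
  · rw [h1, h]
  · rw [h2, h]
  · rfl

theorem le_finrank_fixA_swap (x y : Fin n) :
    n ≤ Module.finrank ℚ (fixA (Equiv.swap x y)) + 1 := by
  let φ : (Fin n → ℚ) →ₗ[ℚ] (Unit → ℚ) :=
    LinearMap.pi fun _ => (LinearMap.proj x : (Fin n → ℚ) →ₗ[ℚ] ℚ) - LinearMap.proj y
  simpa using finrank_le_finrank_add_card (U := fixA (Equiv.swap x y)) φ
    fun g hg => mem_fixA_swap (sub_eq_zero.1 (congrFun hg ()))

theorem finrank_fixA_lt_swap_mul {σ : Equiv.Perm (Fin n)} {x : Fin n} (hx : σ x ≠ x) :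
    Module.finrank ℚ (fixA σ) < Module.finrank ℚ (fixA (Equiv.swap x (σ x) * σ)) := by
  apply Submodule.finrank_lt_finrank_of_lt
  refine lt_of_le_of_ne (fun g hg => fixA_inf_le_mul _ _ ⟨mem_fixA_swap (hg x).symm, hg⟩)
    fun he => ?_
  have h1 : Set.indicator {x} (1 : Fin n → ℚ) ∈ fixA (Equiv.swap x (σ x) * σ) := by
    rw [indicator_mem_fixA]
    intro y
    have : (Equiv.swap x (σ x) * σ) x = x := by simp
    rw [Set.mem_singleton_iff, Set.mem_singleton_iff]
    rw [← (Equiv.swap x (σ x) * σ).injective.eq_iff (a := y), this]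
  rw [← he, indicator_mem_fixA] at h1
  exact hx ((h1 x).2 rfl)

theorem mem_of_sameCycle {σ : Equiv.Perm (Fin n)} {S : Set (Fin n)} (hS : ∀ x ∈ S, σ x ∈ S)
    {x y : Fin n} (h : σ.SameCycle x y) (hx : x ∈ S) : y ∈ S := by
  obtain ⟨k, rfl⟩ := h.exists_nat_pow_eq
  induction k with
  | zero => exact hx
  | succ k ih =>
    rw [pow_succ', Equiv.Perm.mul_apply]
    exact hS _ (ih (by simp [Equiv.Perm.SameCycle.refl]))

theorem mem_of_apply_mem {σ : Equiv.Perm (Fin n)} {S : Set (Fin n)} (hS : ∀ x ∈ S, σ x ∈ S)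
    {x : Fin n} (h : σ x ∈ S) : x ∈ S :=
  mem_of_sameCycle hS (by simp [Equiv.Perm.SameCycle.refl]) h

/-- The number of ascents `x < σ x` of a permutation. -/
def excCount (σ : Equiv.Perm (Fin n)) : ℕ := Fintype.card {x // x < σ x}

theorem finrank_fixA_add_excCount_le (σ : Equiv.Perm (Fin n)) :
    Module.finrank ℚ (fixA σ) + excCount σ ≤ n := by
  let φ : fixA σ →ₗ[ℚ] ({x // ¬ x < σ x} → ℚ) :=
    (LinearMap.pi fun x => LinearMap.proj x.1) ∘ₗ (fixA σ).subtype
  have hφ : Function.Injective φ := by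
    rw [← LinearMap.ker_eq_bot, LinearMap.ker_eq_bot']
    rintro ⟨g, hg⟩ h
    have h0 : ∀ x, g x = 0 := by
      intro x
      induction x using WellFoundedGT.induction with
      | _ x ih =>
        by_cases hx : x < σ x
        · rw [← hg x, ih _ hx]
        · exact congrFun h ⟨x, hx⟩
    ext x
    exact h0 x
  have h1 := LinearMap.finrank_le_finrank_of_injective hφ
  rw [Module.finrank_fintype_fun_eq_card] at h1
  have h2 := Fintype.card_subtype_compl (fun x => x < σ x)
  have h3 := Fintype.card_subtype_le (fun x => x < σ x)
  rw [Fintype.card_fin] at h2 h3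
  rw [excCount]
  omega

theorem le_finrank_fixA_add_excCount {σ : Equiv.Perm (Fin n)}
    (h : ∀ x, σ x ≤ x → ∃ S : Set (Fin n), x ∈ S ∧ (∀ y ∈ S, σ y ∈ S) ∧ ∀ y ∈ S, y ≤ x) :
    n ≤ Module.finrank ℚ (fixA σ) + excCount σ := by
  have hle : ∀ x y, σ x ≤ x → σ.SameCycle x y → y ≤ x := by
    intro x y hx hxy
    obtain ⟨S, hxS, hS, hSx⟩ := h x hx
    exact hSx y (mem_of_sameCycle hS hxy hxS)
  let φ : (Fin n → ℚ) →ₗ[ℚ] ({x // x < σ x} → ℚ) :=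
    LinearMap.pi fun x => (LinearMap.proj (σ x.1) : (Fin n → ℚ) →ₗ[ℚ] ℚ) - LinearMap.proj x.1
  have := finrank_le_finrank_add_card (U := fixA σ) φ ?_
  · simpa [excCount] using this
  · intro g hg x
    have hasc : ∀ x, x < σ x → g (σ x) = g x := fun x hx => sub_eq_zero.1 (congrFun hg ⟨x, hx⟩)
    rcases lt_or_ge x (σ x) with hx | hx
    · exact hasc x hx
    · have key : ∀ y, σ.SameCycle x y → g y = g x := by
        intro y
        induction y using WellFoundedGT.induction with
        | _ y ih =>
          intro hy
          rcases (hle x y hx hy).eq_or_lt with rfl | hlt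
          · rfl
          · rcases lt_or_ge y (σ y) with hy' | hy'
            · rw [← hasc y hy', ih _ hy' (by simpa using hy)]
            · exact absurd (hle y x hy' hy.symm) (not_le.2 hlt)
      exact key _ (by simp [Equiv.Perm.SameCycle.refl])

/-- The permutations associated to non-crossing partitions: every interval strictly between
`x` and its successor, and every interval from the least to the largest element of a cycle,
is invariant. -/
def IsNCPerm (σ : Equiv.Perm (Fin n)) : Prop :=
  (∀ x y, x < σ x → x < y → y < σ x → x < σ y ∧ σ y < σ x) ∧
    ∀ x y, σ x ≤ x → σ x ≤ y → y ≤ x → σ x ≤ σ y ∧ σ y ≤ x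

theorem finRotate_val (k : Fin n) :
    (finRotate n k).val = if k.val + 1 = n then 0 else k.val + 1 := by
  cases n with
  | zero => exact k.elim0
  | succ m =>
    rw [coe_finRotate]
    simp only [Fin.ext_iff, Fin.val_last, Nat.add_right_cancel_iff]

theorem swap_finRotate_mem_Ico {x y : Fin n} (hxy : x < y) (z : Fin n) :
    Equiv.swap x y (finRotate n z) ∈ Set.Ico x y ↔ z ∈ Set.Ico x y := by
  have h := finRotate_val z
  have := z.isLt
  have := y.isLt
  simp only [Set.mem_Ico, Fin.le_def, Fin.lt_def] at *
  rw [Equiv.swap_apply_def]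
  split_ifs at * with h1 h2 h3 <;> simp only [Fin.ext_iff] at * <;> omega

theorem fixA_swap_mul_le {σ c : Equiv.Perm (Fin n)}
    (h : n + Module.finrank ℚ (fixA c) ≤
      Module.finrank ℚ (fixA σ) + Module.finrank ℚ (fixA (σ⁻¹ * c)))
    {x : Fin n} (hx : σ x ≠ x) :
    fixA (Equiv.swap x (σ x) * c) ≤ fixA (Equiv.swap x (σ x) * σ) := by
  set ρ := Equiv.swap x (σ x) with hρ
  have h1 := finrank_fixA_lt_swap_mul hx
  have h2 : fixA ρ ⊓ fixA (ρ * c) ≤ fixA c := by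
    have := fixA_inf_le_mul ρ (ρ * c)
    rwa [← mul_assoc, hρ, Equiv.swap_mul_self, one_mul] at this
  have h3 := finrank_add_finrank_le_of_inf_le h2
  have h4 := le_finrank_fixA_swap x (σ x)
  rw [Module.finrank_fin_fun] at h3
  refine le_left_of_finrank_le (W := fixA (σ⁻¹ * c)) ?_ ?_
  · have := fixA_inf_le_mul (ρ * σ) (σ⁻¹ * c)
    rwa [mul_assoc, mul_inv_cancel_left] at this
  · rw [Module.finrank_fin_fun]
    rw [← hρ] at h1 h4
    omega

theorem isNCPerm_of_finrank_le {σ : Equiv.Perm (Fin n)}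
    (h : n + Module.finrank ℚ (fixA (finRotate n)) ≤
      Module.finrank ℚ (fixA σ) + Module.finrank ℚ (fixA (σ⁻¹ * finRotate n))) :
    IsNCPerm σ := by
  constructor
  · intro x y hx hxy hy
    have hle := fixA_swap_mul_le h hx.ne'
    have h1 := indicator_mem_fixA.1 (hle (indicator_mem_fixA.2 (swap_finRotate_mem_Ico hx))) y
    have hmem := h1.2 ⟨hxy.le, hy⟩
    have h2 : σ y ≠ x := by
      intro h2
      rw [Equiv.Perm.mul_apply, h2, Equiv.swap_apply_left] at hmem
      exact lt_irrefl _ hmem.2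
    have h3 : σ y ≠ σ x := fun h3 => hxy.ne' (σ.injective h3)
    rw [Equiv.Perm.mul_apply, Equiv.swap_apply_of_ne_of_ne h2 h3] at hmem
    exact ⟨lt_of_le_of_ne hmem.1 h2.symm, hmem.2⟩
  · intro x y hx hxy hy
    rcases hx.eq_or_lt with hx | hx
    · obtain rfl : y = x := le_antisymm hy (hx ▸ hxy)
      exact ⟨le_rfl, hx.le⟩
    rcases hy.eq_or_lt with rfl | hy
    · exact ⟨le_rfl, hx.le⟩
    have hle := fixA_swap_mul_le h hx.ne
    rw [Equiv.swap_comm] at hle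
    have h1 := indicator_mem_fixA.1 (hle (indicator_mem_fixA.2 (swap_finRotate_mem_Ico hx))) y
    have hmem := h1.2 ⟨hxy, hy⟩
    have h3 : σ y ≠ σ x := fun h3 => hy.ne (σ.injective h3)
    rw [Equiv.Perm.mul_apply] at hmem
    by_cases h2 : σ y = x
    · rw [h2]
      exact ⟨hx.le, le_rfl⟩
    · rw [Equiv.swap_apply_of_ne_of_ne h3 h2] at hmem
      exact ⟨hmem.1, hmem.2.le⟩

theorem IsNCPerm.exists_invariant {σ : Equiv.Perm (Fin n)} (h : IsNCPerm σ) (x : Fin n)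
    (hx : σ x ≤ x) : ∃ S : Set (Fin n), x ∈ S ∧ (∀ y ∈ S, σ y ∈ S) ∧ ∀ y ∈ S, y ≤ x :=
  ⟨Set.Icc (σ x) x, ⟨hx, le_rfl⟩, fun y hy => h.2 x y hx hy.1 hy.2, fun _ hy => hy.2⟩

theorem IsNCPerm.le_or_le {σ : Equiv.Perm (Fin n)} (h : IsNCPerm σ) {x y : Fin n}
    (hx : x < σ x) (hxy : σ.SameCycle x y) : y ≤ x ∨ σ x ≤ y := by
  by_contra! hy
  exact lt_irrefl x (mem_of_sameCycle (S := Set.Ioo x (σ x))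
    (fun z hz => h.1 x z hx hz.1 hz.2) hxy.symm hy).1

theorem IsNCPerm.mem_Icc {σ : Equiv.Perm (Fin n)} (h : IsNCPerm σ) {x y : Fin n}
    (hx : σ x ≤ x) (hxy : σ.SameCycle x y) : σ x ≤ y ∧ y ≤ x :=
  mem_of_sameCycle (S := Set.Icc (σ x) x) (fun z hz => h.2 x z hx hz.1 hz.2) hxy ⟨hx, le_rfl⟩

/-- The partition of `{1,...,n}` into cycles of a permutation. -/
def cyclePart (σ : Equiv.Perm (Fin n)) : Set (Set (Fin n)) :=
  {B | ∃ x, B = {y | σ.SameCycle x y}}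

theorem IsNCPerm.isIota_cyclePart {σ : Equiv.Perm (Fin n)} (h : IsNCPerm σ) :
    IsIota n (cyclePart σ) σ := by
  rintro _ ⟨z, rfl⟩ a ha
  have ha' : σ.SameCycle z (σ a) := by simpa using ha
  constructor
  · rintro ⟨b, hb, hab⟩
    have hlt : a < σ a := by
      by_contra! hle
      exact not_lt.2 (h.mem_Icc hle (ha.symm.trans hb)).2 hab
    refine ⟨⟨ha', hlt⟩, fun c hc => ?_⟩
    exact (h.le_or_le hlt (ha.symm.trans hc.1)).resolve_left (not_le.2 hc.2)
  · intro hmax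
    exact ⟨ha', fun c hc => (h.mem_Icc (not_lt.1 (hmax _ ha')) (ha.symm.trans hc)).1⟩

theorem IsNCPerm.ncPart_cyclePart {σ : Equiv.Perm (Fin n)} (h : IsNCPerm σ) :
    NCPart (cyclePart σ) := by
  refine ⟨⟨?_, fun a => ⟨{y | σ.SameCycle a y}, ⟨⟨a, rfl⟩, Equiv.Perm.SameCycle.refl _ _⟩, ?_⟩⟩, ?_⟩
  · rintro _ ⟨x, rfl⟩
    exact ⟨x, Equiv.Perm.SameCycle.refl _ _⟩
  · rintro _ ⟨⟨x, rfl⟩, hx⟩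
    ext y
    exact ⟨fun hy => hx.symm.trans hy, fun hy => hx.trans hy⟩
  · rintro _ ⟨u, rfl⟩ _ ⟨v, rfl⟩ a b c d hab hbc hcd ha hc hb hd
    change σ.SameCycle u b
    by_contra hbB
    obtain ⟨x, ⟨hxu, hxb⟩, hxmax⟩ := Set.Finite.exists_maximal
      (s := {x | σ.SameCycle u x ∧ x < b}) (Set.toFinite _) ⟨a, ha, hab⟩
    have hx' : σ.SameCycle u (σ x) := by simpa using hxu
    have hlt : x < σ x := by
      by_contra! hle
      exact not_lt.2 (h.mem_Icc hle (hxu.symm.trans hc)).2 (hxb.trans hbc)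
    have hge : b < σ x := by
      rcases lt_trichotomy b (σ x) with h1 | h1 | h1
      · exact h1
      · exact absurd (h1 ▸ hx') hbB
      · exact absurd (hxmax ⟨hx', h1⟩ hlt.le) (not_le.2 hlt)
    have hd' : d ∈ Set.Ioo x (σ x) := mem_of_sameCycle (S := Set.Ioo x (σ x))
      (fun z hz => h.1 x z hlt hz.1 hz.2) (hb.symm.trans hd) ⟨hxb, hge⟩
    rcases h.le_or_le hlt (hxu.symm.trans hc) with h1 | h1
    · exact not_lt.2 h1 (hxb.trans hbc)
    · exact not_lt.2 h1 (hcd.trans hd'.2)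

end Permutations

section CyclicSuccessor

/-- `j` is the cyclic successor of `i` in `F`. -/
def IsCycSucc {α : Type*} [LinearOrder α] (F : Set α) (i j : α) : Prop :=
  ((∃ b ∈ F, i < b) → IsLeast {b | b ∈ F ∧ i < b} j) ∧ ((∀ b ∈ F, ¬ i < b) → IsLeast F j)

variable {α β : Type*} [LinearOrder α] [LinearOrder β] {F : Set α} {i j : α}

theorem IsCycSucc.mem (h : IsCycSucc F i j) : j ∈ F := by
  by_cases hb : ∃ b ∈ F, i < b
  · exact (h.1 hb).1.1
  · exact (h.2 (by simpa using hb)).1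

theorem IsCycSucc.unique {j' : α} (h : IsCycSucc F i j) (h' : IsCycSucc F i j') : j = j' := by
  by_cases hb : ∃ b ∈ F, i < b
  · exact (h.1 hb).unique (h'.1 hb)
  · exact (h.2 (by simpa using hb)).unique (h'.2 (by simpa using hb))

theorem IsCycSucc.le_or_le (h : IsCycSucc F i j) {y : α} (hy : y ∈ F) :
    y ≤ i ∨ j ≤ y := by
  by_contra! hy'
  exact not_le.2 hy'.2 ((h.1 ⟨y, hy, hy'.1⟩).2 ⟨hy, hy'.1⟩)

theorem IsCycSucc.mem_Icc (h : IsCycSucc F i j) (hij : j ≤ i) {y : α} (hy : y ∈ F) :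
    j ≤ y ∧ y ≤ i := by
  have hmax : ∀ b ∈ F, ¬ i < b := fun b hb hib =>
    not_lt.2 hij (h.1 ⟨b, hb, hib⟩).1.2
  exact ⟨(h.2 hmax).2 hy, not_lt.1 (hmax y hy)⟩

theorem isCycSucc_image {f : α → β} (hf : StrictMono f) :
    IsCycSucc (f '' F) (f i) (f j) ↔ IsCycSucc F i j := by
  simp only [IsCycSucc, IsLeast, mem_lowerBounds, Set.mem_ofPred_eq, Set.exists_mem_image,
    Set.forall_mem_image, and_imp, hf.lt_iff_lt, hf.le_iff_le, hf.injective.mem_set_image]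

end CyclicSuccessor

section NonCrossing

variable {n : ℕ}

theorem isIota_iff {N : ℕ} {p : Set (Set (Fin N))} {σ : Equiv.Perm (Fin N)} :
    IsIota N p σ ↔ ∀ B ∈ p, ∀ a ∈ B, IsCycSucc B a (σ a) := Iff.rfl

theorem IsPartition.eq_of_mem {α : Type*} {p : Set (Set α)} (hp : IsPartition p) {B C : Set α}
    (hB : B ∈ p) (hC : C ∈ p) {a : α} (haB : a ∈ B) (haC : a ∈ C) : B = C :=
  (hp.2 a).unique ⟨hB, haB⟩ ⟨hC, haC⟩

theorem IsIota.apply_mem {p : Set (Set (Fin n))} {σ : Equiv.Perm (Fin n)} (h : IsIota n p σ)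
    {B : Set (Fin n)} (hB : B ∈ p) {a : Fin n} (ha : a ∈ B) : σ a ∈ B :=
  IsCycSucc.mem (h B hB a ha)

theorem isNCPerm_of_isIota {p : Set (Set (Fin n))} {σ : Equiv.Perm (Fin n)} (hp : NCPart p)
    (h : IsIota n p σ) : IsNCPerm σ := by
  constructor
  · intro x y hx hxy hy
    obtain ⟨B, ⟨hB, hxB⟩, -⟩ := hp.1.2 x
    obtain ⟨C, ⟨hC, hyC⟩, -⟩ := hp.1.2 y
    have hσx := h.apply_mem hB hxB
    have hσy := h.apply_mem hC hyC
    have hyB : y ∉ B := fun hyB => by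
      rcases IsCycSucc.le_or_le (h B hB x hxB) hyB with h1 | h1
      · exact not_le.2 hxy h1
      · exact not_le.2 hy h1
    have hdisj : ∀ z ∈ C, z ∉ B := fun z hz hzB =>
      hyB (hp.1.eq_of_mem hC hB hz hzB ▸ hyC)
    constructor
    · by_contra! hle
      rcases hle.eq_or_lt with h1 | h1
      · exact hdisj _ hσy (h1 ▸ hxB)
      · exact hdisj x (hp.2 C hC B hB _ _ _ _ h1 hxy hy hσy hyC hxB hσx) hxB
    · by_contra! hle
      rcases hle.eq_or_lt with h1 | h1
      · exact hdisj _ hσy (h1 ▸ hσx)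
      · exact hyB (hp.2 B hB C hC _ _ _ _ hxy hy h1 hxB hσx hyC hσy)
  · intro x y hx hxy hy
    obtain ⟨B, ⟨hB, hxB⟩, -⟩ := hp.1.2 x
    obtain ⟨C, ⟨hC, hyC⟩, -⟩ := hp.1.2 y
    have hσx := h.apply_mem hB hxB
    have hσy := h.apply_mem hC hyC
    by_cases hyB : y ∈ B
    · exact IsCycSucc.mem_Icc (h B hB x hxB) hx (h.apply_mem hB hyB)
    · have h1 : σ x < y := lt_of_le_of_ne hxy fun h1 => hyB (h1 ▸ hσx)
      have h2 : y < x := lt_of_le_of_ne hy fun h2 => hyB (h2 ▸ hxB)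
      constructor
      · by_contra! hlt
        have h3 := hp.2 C hC B hB _ _ _ _ hlt h1 h2 hσy hyC hσx hxB
        exact hyB (hp.1.eq_of_mem hC hB h3 hσx ▸ hyC)
      · by_contra! hlt
        exact hyB (hp.2 B hB C hC _ _ _ _ h1 h2 hlt hσx hxB hyC hσy)

theorem IsIota.subset_of_invariant {p : Set (Set (Fin n))} {σ : Equiv.Perm (Fin n)}
    (h : IsIota n p σ) {B S : Set (Fin n)} (hB : B ∈ p) (hS : ∀ x ∈ S, σ x ∈ S)
    {a : Fin n} (haB : a ∈ B) (haS : a ∈ S) : B ⊆ S := by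
  obtain ⟨m, ⟨hmB, hmS⟩, hmax⟩ := Set.Finite.exists_maximal (s := B ∩ S) (Set.toFinite _)
    ⟨a, haB, haS⟩
  have hσm : σ m ≤ m := by
    by_contra! hlt
    exact not_le.2 hlt (hmax ⟨h.apply_mem hB hmB, hS m hmS⟩ hlt.le)
  by_contra hBS
  obtain ⟨y, ⟨hyB, hyS⟩, hmin⟩ := Set.Finite.exists_minimal (s := B \ S) (Set.toFinite _)
    (Set.sdiff_nonempty.2 hBS)
  have hmy : σ m < y := lt_of_le_of_ne (IsCycSucc.mem_Icc (h B hB m hmB) hσm hyB).1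
    fun he => hyS (he ▸ hS m hmS)
  obtain ⟨z, ⟨hzB, hzy⟩, hzmax⟩ := Set.Finite.exists_maximal (s := {z | z ∈ B ∧ z < y})
    (Set.toFinite _) ⟨σ m, h.apply_mem hB hmB, hmy⟩
  have hzS : z ∈ S := by
    by_contra hzS
    exact not_le.2 hzy (hmin ⟨hzB, hzS⟩ hzy.le)
  have hlt : z < σ z := by
    by_contra! hle
    exact not_le.2 hzy (IsCycSucc.mem_Icc (h B hB z hzB) hle hyB).2
  have hle := (IsCycSucc.le_or_le (h B hB z hzB) hyB).resolve_left (not_le.2 hzy)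
  rcases hle.eq_or_lt with he | hlt'
  · exact hyS (he ▸ hS z hzS)
  · exact not_le.2 hlt (hzmax ⟨h.apply_mem hB hzB, hlt'⟩ hlt.le)

theorem refines_of_fixA_le {p₁ p₂ : Set (Set (Fin n))} {σ₁ σ₂ : Equiv.Perm (Fin n)}
    (hp₁ : NCPart p₁) (hp₂ : NCPart p₂) (h₁ : IsIota n p₁ σ₁) (h₂ : IsIota n p₂ σ₂)
    (h : fixA σ₂ ≤ fixA σ₁) : Refines p₁ p₂ := by
  intro B hB
  obtain ⟨x, hx⟩ := hp₁.1.1 B hB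
  obtain ⟨C, ⟨hC, hxC⟩, -⟩ := hp₂.1.2 x
  refine ⟨C, hC, h₁.subset_of_invariant hB (fun y => ?_) hx hxC⟩
  exact (indicator_mem_fixA.1 (h (indicator_mem_fixA.2 fun y =>
    ⟨mem_of_apply_mem fun y => h₂.apply_mem hC, h₂.apply_mem hC⟩)) y).2

theorem exists_invariant_of_apply_mem {p₂ : Set (Set (Fin n))} {σ₁ σ₂ : Equiv.Perm (Fin n)}
    (hσ₁ : IsNCPerm σ₁) (hp₂ : NCPart p₂) (h₂ : IsIota n p₂ σ₂)
    (hmem : ∀ C ∈ p₂, ∀ x ∈ C, σ₁ x ∈ C) (x : Fin n) (hx : (σ₁⁻¹ * σ₂) x ≤ x) :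
    ∃ S : Set (Fin n), x ∈ S ∧ (∀ y ∈ S, (σ₁⁻¹ * σ₂) y ∈ S) ∧ ∀ y ∈ S, y ≤ x := by
  set κ := σ₁⁻¹ * σ₂ with hκ
  have hσκ : ∀ y, σ₁ (κ y) = σ₂ y := fun y => by simp [hκ]
  obtain ⟨C, ⟨hC, hxC⟩, -⟩ := hp₂.1.2 x
  have hκC : ∀ y ∈ C, κ y ∈ C := fun y hy =>
    mem_of_apply_mem (hmem C hC) (by rw [hσκ]; exact h₂.apply_mem hC hy)
  have hsucc := h₂ C hC
  refine ⟨{y | y ∈ C ∧ κ x ≤ y ∧ y ≤ x}, ⟨hxC, hx, le_rfl⟩, ?_, fun y hy => hy.2.2⟩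
  rintro y ⟨hyC, hvy, hyx⟩
  rcases hyx.eq_or_lt with rfl | hyx
  · exact ⟨hκC _ hyC, le_rfl, hx⟩
  refine ⟨hκC y hyC, ?_⟩
  have hy : y < σ₂ y := by
    by_contra! hle
    exact not_le.2 hyx (IsCycSucc.mem_Icc (hsucc y hyC) hle hxC).2
  rcases lt_or_ge x (σ₂ x) with hlt | hge
  · have hux : σ₂ y ≤ x :=
      (IsCycSucc.le_or_le (hsucc y hyC) hxC).resolve_left (not_le.2 hyx)
    have hv : κ x < σ₁ (κ x) := by
      rw [hσκ]
      exact hx.trans_lt hlt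
    have ht : κ y ∈ Set.Ioo (κ x) (σ₁ (κ x)) := by
      refine mem_of_apply_mem (fun z hz => hσ₁.1 (κ x) z hv hz.1 hz.2) ?_
      rw [hσκ, hσκ]
      exact ⟨hvy.trans_lt hy, hux.trans_lt hlt⟩
    rw [hσκ] at ht
    exact ⟨ht.1.le, (IsCycSucc.le_or_le (hsucc x hxC) (hκC y hyC)).resolve_right
      (not_le.2 ht.2)⟩
  · refine ⟨?_, (IsCycSucc.mem_Icc (hsucc x hxC) hge (hκC y hyC)).2⟩
    by_contra! hlt
    have hmin : ∀ z ∈ C, σ₁ (κ x) ≤ z := fun z hz => by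
      rw [hσκ]
      exact (IsCycSucc.mem_Icc (hsucc x hxC) hge hz).1
    have := (hσ₁.2 (κ x) (κ y) (hmin _ (hκC x hxC)) (hmin _ (hκC y hyC)) hlt.le).2
    rw [hσκ y] at this
    exact not_lt.2 (this.trans hvy) hy

theorem excCount_add_excCount_le {p₂ : Set (Set (Fin n))} {σ₁ σ₂ : Equiv.Perm (Fin n)}
    (hp₂ : NCPart p₂) (h₂ : IsIota n p₂ σ₂) (hmem : ∀ C ∈ p₂, ∀ x ∈ C, σ₁ x ∈ C) :
    excCount σ₁ + excCount (σ₁⁻¹ * σ₂) ≤ excCount σ₂ := by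
  set κ := σ₁⁻¹ * σ₂ with hκ
  have hσκ : ∀ y, σ₁ (κ y) = σ₂ y := fun y => by simp [hκ]
  have hκC : ∀ C ∈ p₂, ∀ y ∈ C, κ y ∈ C := fun C hC y hy =>
    mem_of_apply_mem (hmem C hC) (by rw [hσκ]; exact h₂.apply_mem hC hy)
  have h1 : excCount σ₁ = Fintype.card {x // κ x < σ₂ x} :=
    (Fintype.card_congr (κ.subtypeEquiv fun x => by rw [hσκ])).symm
  rw [h1, excCount, excCount, ← Fintype.card_subtype_or_disjoint]
  · refine Fintype.card_subtype_mono _ _ fun x hx => ?_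
    obtain ⟨C, ⟨hC, hxC⟩, -⟩ := hp₂.1.2 x
    by_contra! hle
    have h3 := IsCycSucc.mem_Icc (h₂ C hC x hxC) hle (hκC C hC x hxC)
    rcases hx with hx | hx
    · exact not_lt.2 h3.1 hx
    · exact not_lt.2 h3.2 hx
  · rw [Pi.disjoint_iff]
    intro x
    rw [Prop.disjoint_iff]
    by_contra! hx
    obtain ⟨C, ⟨hC, hxC⟩, -⟩ := hp₂.1.2 x
    rcases IsCycSucc.le_or_le (h₂ C hC x hxC) (hκC C hC x hxC) with h3 | h3
    · exact not_lt.2 h3 hx.2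
    · exact not_lt.2 h3 hx.1

theorem finrank_fixA_add_of_refines {p₁ p₂ : Set (Set (Fin n))} {σ₁ σ₂ : Equiv.Perm (Fin n)}
    (hp₁ : NCPart p₁) (hp₂ : NCPart p₂) (h₁ : IsIota n p₁ σ₁) (h₂ : IsIota n p₂ σ₂)
    (h : Refines p₁ p₂) :
    Module.finrank ℚ (fixA σ₁) + Module.finrank ℚ (fixA (σ₁⁻¹ * σ₂)) =
      n + Module.finrank ℚ (fixA σ₂) := by
  have hσ₁ := isNCPerm_of_isIota hp₁ h₁
  have hmem : ∀ C ∈ p₂, ∀ x ∈ C, σ₁ x ∈ C := by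
    intro C hC x hxC
    obtain ⟨B, ⟨hB, hxB⟩, -⟩ := hp₁.1.2 x
    obtain ⟨C', hC', hBC⟩ := h B hB
    rw [hp₂.1.eq_of_mem hC hC' hxC (hBC hxB)]
    exact hBC (h₁.apply_mem hB hxB)
  have e1 := finrank_add_finrank_le_of_inf_le (fixA_inf_le_mul σ₁ (σ₁⁻¹ * σ₂))
  rw [mul_inv_cancel_left, Module.finrank_fin_fun] at e1
  have e2 := le_finrank_fixA_add_excCount hσ₁.exists_invariant
  have e3 := le_finrank_fixA_add_excCount (exists_invariant_of_apply_mem hσ₁ hp₂ h₂ hmem)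
  have e4 := finrank_fixA_add_excCount_le σ₂
  have e5 := excCount_add_excCount_le hp₂ h₂ hmem
  omega

theorem ncPart_singleton_univ (hn : 0 < n) : NCPart ({Set.univ} : Set (Set (Fin n))) := by
  refine ⟨⟨?_, fun a => ⟨Set.univ, ⟨rfl, trivial⟩, fun B hB => hB.1⟩⟩, ?_⟩
  · rintro B rfl
    exact ⟨⟨0, hn⟩, trivial⟩
  · rintro B rfl C rfl a b c d - - - - - - -
    trivial

theorem isIota_singleton_univ : IsIota n {Set.univ} (finRotate n) := by
  rintro B rfl a -
  have h := finRotate_val a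
  simp only [IsLeast, mem_lowerBounds, Set.mem_univ, true_and, forall_const, Set.mem_ofPred_eq,
    Fin.lt_def, Fin.le_def]
  constructor
  · rintro ⟨b, hb⟩
    have := b.isLt
    rw [h, if_neg (by omega)]
    exact ⟨by omega, fun c hc => hc⟩
  · intro ha b
    have h1 := ha (finRotate n a)
    have := a.isLt
    split_ifs at h <;> omega

end NonCrossing

section Doubling

variable {n : ℕ}

/-- `τ` acts as `σ` both on `{1,...,n}` and on `{-1,...,-n}`. -/
def IsDouble (τ : Equiv.Perm (Fin (2 * n))) (σ : Equiv.Perm (Fin n)) : Prop :=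
  ∀ i, τ (castEmb n i) = castEmb n (σ i) ∧
    τ (negMap n (castEmb n i)) = negMap n (castEmb n (σ i))

theorem strictMono_castEmb : StrictMono (castEmb n) := fun _ _ h => h

theorem negMap_castEmb_val (i : Fin n) : (negMap n (castEmb n i)).val = i.val + n := by
  rw [negMap_val]
  exact if_pos i.isLt

theorem strictMono_negMap_castEmb : StrictMono fun i => negMap n (castEmb n i) := fun i j h => by
  change (negMap n (castEmb n i)).val < (negMap n (castEmb n j)).val
  rw [negMap_castEmb_val, negMap_castEmb_val]
  exact Nat.add_lt_add_right h n

theorem IsDouble.inWn {τ : Equiv.Perm (Fin (2 * n))} {σ : Equiv.Perm (Fin n)}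
    (h : IsDouble τ σ) : InWn n τ := fun k => by
  rcases castEmb_or_negMap k with ⟨i, rfl⟩ | ⟨i, rfl⟩
  · rw [(h i).1, (h i).2]
  · rw [negMap_negMap, (h i).1, (h i).2, negMap_negMap]

theorem IsDouble.inv_mul {τ τ' : Equiv.Perm (Fin (2 * n))} {σ σ' : Equiv.Perm (Fin n)}
    (h : IsDouble τ σ) (h' : IsDouble τ' σ') : IsDouble (τ⁻¹ * τ') (σ⁻¹ * σ') := fun i => by
  simp only [Equiv.Perm.mul_apply]
  rw [(h' i).1, (h' i).2, Equiv.Perm.inv_eq_iff_eq, Equiv.Perm.inv_eq_iff_eq, (h _).1, (h _).2]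
  simp

theorem IsDouble.fixB_eq {τ : Equiv.Perm (Fin (2 * n))} {σ : Equiv.Perm (Fin n)}
    (h : IsDouble τ σ) : fixB τ = fixA σ := by
  ext g
  constructor
  · intro hg i
    have := hg (castEmb n i)
    rwa [(h i).1, oddExt_castEmb, oddExt_castEmb] at this
  · intro hg k
    rcases castEmb_or_negMap k with ⟨i, rfl⟩ | ⟨i, rfl⟩
    · rw [(h i).1, oddExt_castEmb, oddExt_castEmb, hg i]
    · rw [(h i).2, oddExt_negMap, oddExt_negMap, oddExt_castEmb, oddExt_castEmb, hg i]

theorem IsDouble.leB_iff {τ τ' : Equiv.Perm (Fin (2 * n))} {σ σ' : Equiv.Perm (Fin n)}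
    (h : IsDouble τ σ) (h' : IsDouble τ' σ') : leB n τ τ' ↔
      Module.finrank ℚ (fixA σ) + Module.finrank ℚ (fixA (σ⁻¹ * σ')) =
        n + Module.finrank ℚ (fixA σ') := by
  rw [leB_iff_of_inWn h.inWn h'.inWn, h.fixB_eq, h'.fixB_eq, (h.inv_mul h').fixB_eq]

theorem isDouble_gammaW (hn : 0 < n) : IsDouble (gammaW n hn) (finRotate n) := by
  intro i
  have hi := i.isLt
  have h := finRotate_val i
  constructor
  · rw [gammaW, Equiv.Perm.mul_apply]
    ext
    rw [finRotate_val]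
    simp only [castEmb, h, Equiv.swap_apply_def, Fin.ext_iff]
    split_ifs <;> simp only at * <;> omega
  · rw [gammaW, Equiv.Perm.mul_apply]
    ext
    rw [finRotate_val, negMap_castEmb_val, h]
    simp only [Equiv.swap_apply_def, Fin.ext_iff, negMap_castEmb_val]
    split_ifs <;> (try simp only [negMap_castEmb_val] at *) <;> omega

theorem exists_isDouble_of_one_mem {τ : Equiv.Perm (Fin (2 * n))} (hτ : InWn n τ)
    (h : (1 : Fin n → ℚ) ∈ fixB τ) : ∃ σ, IsDouble τ σ := by
  have hc : ∀ i, ∃ j, τ (castEmb n i) = castEmb n j := by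
    intro i
    rcases castEmb_or_negMap (τ (castEmb n i)) with hj | ⟨j, hj⟩
    · exact hj
    · have := h (castEmb n i)
      rw [hj, oddExt_negMap, oddExt_castEmb, oddExt_castEmb] at this
      norm_num at this
  choose f hf using hc
  have hinj : Function.Injective f := fun i j hij => by
    have := hf i
    rw [hij, ← hf j] at this
    exact strictMono_castEmb.injective (τ.injective this)
  exact ⟨Equiv.ofBijective f (Finite.injective_iff_bijective.1 hinj), fun i =>
    ⟨hf i, by rw [hτ, hf]; rfl⟩⟩

theorem mem_iotaO {p : Set (Set (Fin n))} {X : Set (Fin (2 * n))} :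
    X ∈ iotaO n p ↔ ∃ F ∈ p, X = castEmb n '' F ∨ X = (fun i => negMap n (castEmb n i)) '' F := by
  simp only [iotaO, negSet, Set.image_image, Set.mem_ofPred_eq]

theorem IsDouble.isIota_iotaO {p : Set (Set (Fin n))} {τ : Equiv.Perm (Fin (2 * n))}
    {σ : Equiv.Perm (Fin n)} (h : IsDouble τ σ) (hp : IsIota n p σ) :
    IsIota (2 * n) (iotaO n p) τ := by
  rw [isIota_iff]
  intro X hX
  obtain ⟨F, hF, rfl | rfl⟩ := mem_iotaO.1 hX
  · rintro _ ⟨i, hi, rfl⟩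
    rw [(h i).1, isCycSucc_image strictMono_castEmb]
    exact hp F hF i hi
  · rintro _ ⟨i, hi, rfl⟩
    rw [(h i).2, isCycSucc_image strictMono_negMap_castEmb]
    exact hp F hF i hi

theorem exists_isDouble_of_isIota {p : Set (Set (Fin n))} {τ : Equiv.Perm (Fin (2 * n))}
    (hp : NCPart p) (h : IsIota (2 * n) (iotaO n p) τ) :
    ∃ σ, IsDouble τ σ ∧ IsIota n p σ := by
  rw [isIota_iff] at h
  have hc : ∀ i, ∃ j, (τ (castEmb n i) = castEmb n j ∧
      τ (negMap n (castEmb n i)) = negMap n (castEmb n j)) ∧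
      ∀ F ∈ p, i ∈ F → IsCycSucc F i j := by
    intro i
    obtain ⟨F, ⟨hF, hi⟩, hu⟩ := hp.1.2 i
    have h1 := h _ (mem_iotaO.2 ⟨F, hF, Or.inl rfl⟩) _ ⟨i, hi, rfl⟩
    have h2 := h _ (mem_iotaO.2 ⟨F, hF, Or.inr rfl⟩) _ ⟨i, hi, rfl⟩
    obtain ⟨j, hj, hj'⟩ := h1.mem
    obtain ⟨k, hk, hk'⟩ := h2.mem
    rw [← hj', isCycSucc_image strictMono_castEmb] at h1
    rw [← hk', isCycSucc_image (f := fun i => negMap n (castEmb n i))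
      strictMono_negMap_castEmb] at h2
    obtain rfl := h1.unique h2
    refine ⟨j, ⟨hj'.symm, hk'.symm⟩, fun F' hF' hi' => ?_⟩
    rwa [hu F' ⟨hF', hi'⟩]
  choose f hf hf' using hc
  have hinj : Function.Injective f := fun i j hij => by
    have := (hf i).1
    rw [hij, ← (hf j).1] at this
    exact strictMono_castEmb.injective (τ.injective this)
  exact ⟨Equiv.ofBijective f (Finite.injective_iff_bijective.1 hinj), hf,
    fun F hF i hi => hf' i F hF hi⟩

theorem inWn_of_leB_gammaW (hn : 0 < n) {τ : Equiv.Perm (Fin (2 * n))}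
    (h : leB n τ (gammaW n hn)) : InWn n τ := by
  by_contra hτ
  have hγ := (isDouble_gammaW hn).inWn
  have hτ' : ¬ InWn n (τ⁻¹ * gammaW n hn) := fun h' => hτ (by
    have := hγ.mul h'.inv
    rwa [mul_inv_rev, inv_inv, mul_inv_cancel_left] at this)
  rw [leB, lenB_eq_zero_of_not_inWn hτ, lenB_eq_zero_of_not_inWn hτ'] at h
  have h1 := lenB_add_finrank_fixB hγ
  obtain ⟨l, -, hp, hl⟩ := exists_list_of_inWn hγ
  obtain rfl : l = [] := List.length_eq_zero_iff.1 (by omega)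
  have h2 := congrArg Fin.val ((isDouble_gammaW hn ⟨0, hn⟩).1)
  rw [← hp, List.prod_nil] at h2
  change 0 = (finRotate n ⟨0, hn⟩).val at h2
  rw [finRotate_val] at h2
  obtain rfl : n = 1 := by
    split_ifs at h2 with h3
    simpa using h3.symm
  have hall : ∀ τ : Equiv.Perm (Fin (2 * 1)), ∀ k, τ (negMap 1 k) = negMap 1 (τ k) := by decide
  exact hτ (hall τ)

end Doubling

end NCPB

open NCPB in
/-- For `γ = (1,2,...,n)(-1,-2,...,-n) ∈ W_n`, the composite
`ι ∘ ι₀` has range the interval `[ε, γ] ⊆ W_n` and induces a poset isomorphism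
between `NC^A(n)` and `[ε, γ]`. -/
theorem iota_iotaO_orderIso_NCA_interval (n : ℕ) (hn : 0 < n) :
    (∀ τ : Equiv.Perm (Fin (2*n)),
        (∃ p, NCPart p ∧ IsIota (2*n) (iotaO n p) τ) ↔
          (leB n 1 τ ∧ leB n τ (gammaW n hn))) ∧
    (∀ (p₁ p₂ : Set (Set (Fin n))) (τ₁ τ₂ : Equiv.Perm (Fin (2*n))),
        NCPart p₁ → NCPart p₂ →
        IsIota (2*n) (iotaO n p₁) τ₁ → IsIota (2*n) (iotaO n p₂) τ₂ →
        (Refines p₁ p₂ ↔ leB n τ₁ τ₂)) := by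
  refine ⟨fun τ => ⟨?_, ?_⟩, ?_⟩
  · rintro ⟨p, hp, h⟩
    obtain ⟨σ, hd, hσ⟩ := exists_isDouble_of_isIota hp h
    refine ⟨leB_one τ, (hd.leB_iff (isDouble_gammaW hn)).2 ?_⟩
    exact finrank_fixA_add_of_refines hp (ncPart_singleton_univ hn) hσ isIota_singleton_univ
      fun B _ => ⟨Set.univ, rfl, Set.subset_univ B⟩
  · rintro ⟨-, h⟩
    have hτ := inWn_of_leB_gammaW hn h
    have hγ := isDouble_gammaW hn
    have hone : (1 : Fin n → ℚ) ∈ fixB τ :=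
      fixB_le_of_leB hτ hγ.inWn h (hγ.fixB_eq ▸ fun _ => rfl)
    obtain ⟨σ, hd⟩ := exists_isDouble_of_one_mem hτ hone
    have hσ := isNCPerm_of_finrank_le ((hd.leB_iff hγ).1 h).ge
    exact ⟨cyclePart σ, hσ.ncPart_cyclePart, hd.isIota_iotaO hσ.isIota_cyclePart⟩
  · intro p₁ p₂ τ₁ τ₂ hp₁ hp₂ h₁ h₂
    obtain ⟨σ₁, hd₁, hσ₁⟩ := exists_isDouble_of_isIota hp₁ h₁
    obtain ⟨σ₂, hd₂, hσ₂⟩ := exists_isDouble_of_isIota hp₂ h₂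
    refine ⟨fun h => (hd₁.leB_iff hd₂).2 (finrank_fixA_add_of_refines hp₁ hp₂ hσ₁ hσ₂ h),
      fun h => refines_of_fixA_le hp₁ hp₂ hσ₁ hσ₂ ?_⟩
    rw [← hd₁.fixB_eq, ← hd₂.fixB_eq]
    exact fixB_le_of_leB hd₁.inWn hd₂.inWn h
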